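/- (The simple strategy is at most two from optimal) Let n ≥ 2 be a natural number, let ℓ be the least natural number with n ≤ 2^ℓ, and let q be the least natural number with 2^ℓ · (q + 1) ≤ 2^q, and suppose q ≥ 4. Then W q n 0 and ¬ W (q − 3) n 0; that is, q − 2 ≤ q₁(n) ≤ q. -/

import Mathlib

/-- `W j a b` : the questioner can force a win within `j` questions from
state `(a, b)` (a = candidates fitting all answers, b = candidates fitting
all but exactly one answer) in Ulam's liar game with one lie. -/
def W : ℕ → ℕ → ℕ → Prop
  | 0, a, b => a + b ≤ 1
  | (j+1), a, b => ∃ a₁ a₂ b₁ b₂ : ℕ, a₁ + a₂ = a ∧ b₁ + b₂ = b ∧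
      W j a₁ (b₁ + a₂) ∧ W j a₂ (b₂ + a₁)

theorem W.volume_bound {j a b : ℕ} (h : W j a b) : a * (j + 1) + b ≤ 2 ^ j := by
  induction j generalizing a b with
  | zero => simpa [W] using h
  | succ j ih =>
    obtain ⟨a₁, a₂, b₁, b₂, rfl, rfl, h₁, h₂⟩ := h
    have := ih h₁
    have := ih h₂
    rw [pow_succ]
    linarith

theorem W.mono {j a b a' b' : ℕ} (h : W j a b) (ha : a' ≤ a) (hb : b' ≤ b) : W j a' b' := by
  induction j generalizing a b a' b' with
  | zero =>
    simp only [W] at h ⊢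
    omega
  | succ j ih =>
    obtain ⟨a₁, a₂, b₁, b₂, rfl, rfl, h₁, h₂⟩ := h
    exact ⟨min a₁ a', a' - min a₁ a', min b₁ b', b' - min b₁ b', by omega, by omega,
      ih h₁ (by omega) (by omega), ih h₂ (by omega) (by omega)⟩

theorem W_zero_left {j b : ℕ} (h : b ≤ 2 ^ j) : W j 0 b := by
  induction j generalizing b with
  | zero => simpa [W] using h
  | succ j ih =>
    rw [pow_succ] at h
    exact ⟨0, 0, b / 2, b - b / 2, rfl, by omega, ih (by omega), ih (by omega)⟩

theorem W_one_left {j b : ℕ} (h : j + 1 + b ≤ 2 ^ j) : W j 1 b := by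
  induction j generalizing b with
  | zero => simpa [W] using h
  | succ j ih =>
    rw [pow_succ] at h
    have hj : j + 1 ≤ 2 ^ j := Nat.lt_two_pow_self
    exact ⟨1, 0, min b (2 ^ j - (j + 1)), b - min b (2 ^ j - (j + 1)), rfl, by omega,
      ih (by omega), W_zero_left (by omega)⟩

/-- Halving both kinds of candidates `k` times leads from `(2 ^ k, i * 2 ^ k)` to `(1, i + k)`. -/
theorem W_two_pow_of_W_one {j k i : ℕ} (h : W j 1 (i + k)) : W (j + k) (2 ^ k) (i * 2 ^ k) := by
  induction k generalizing i with
  | zero => simpa using h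
  | succ k ih =>
    have hk : W (j + k) (2 ^ k) (i * 2 ^ k + 2 ^ k) := by
      rw [← Nat.succ_mul]
      exact ih (by rwa [Nat.succ_add, ← Nat.add_succ])
    exact ⟨2 ^ k, 2 ^ k, i * 2 ^ k, i * 2 ^ k, by ring, by ring, hk, hk⟩

theorem two_from_optimal (n ℓ q : ℕ) (hn : 2 ≤ n)
    (hℓ : IsLeast {m : ℕ | n ≤ 2 ^ m} ℓ)
    (hq : IsLeast {m : ℕ | 2 ^ ℓ * (m + 1) ≤ 2 ^ m} q)
    (hq4 : 4 ≤ q) :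
    W q n 0 ∧ ¬ W (q - 3) n 0 := by
  obtain ⟨hnℓ, hℓ_min⟩ := hℓ
  obtain ⟨hqℓ, hq_min⟩ := hq
  rw [Set.mem_ofPred_eq] at hnℓ hqℓ
  constructor
  · have hle : ℓ ≤ q := (Nat.pow_le_pow_iff_right one_lt_two).1
      ((Nat.le_mul_of_pos_right _ q.succ_pos).trans hqℓ)
    obtain ⟨j, rfl⟩ := Nat.exists_eq_add_of_le' hle
    have hj : j + 1 + ℓ ≤ 2 ^ j := by
      rw [pow_add, mul_comm (2 ^ j)] at hqℓ
      have := Nat.le_of_mul_le_mul_left hqℓ (by positivity)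
      omega
    have h := W_two_pow_of_W_one (i := 0) (k := ℓ) (by simpa using W_one_left hj)
    exact h.mono hnℓ (Nat.zero_le _)
  · intro h
    have hvol := h.volume_bound
    obtain ⟨r, rfl⟩ := Nat.exists_eq_add_of_le' hq4
    have hr : 2 ^ (r + 3) < 2 ^ ℓ * (r + 4) := by
      by_contra! hcon
      have := hq_min (show r + 3 ∈ {m : ℕ | 2 ^ ℓ * (m + 1) ≤ 2 ^ m} from hcon)
      omega
    cases ℓ with
    | zero => omega
    | succ k =>
      have hk : 2 ^ k < n := by
        by_contra! hcon
        have := hℓ_min (show k ∈ {m : ℕ | n ≤ 2 ^ m} from hcon)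
        omega
      rw [show r + 4 - 3 = r + 1 by omega] at hvol
      have hmul : 2 ^ k * (r + 2) ≤ n * (r + 2) := Nat.mul_le_mul_right _ hk.le
      have hnonneg : 0 ≤ 2 ^ k * r := Nat.zero_le _
      simp only [pow_succ] at hr hvol
      nlinarith
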